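/- Let V = F_q^n carry a non-degenerate symplectic form and G = Sp(V) be the full isometry group. For any 1 ≤ j ≤ n, the number of G-orbits on ordered j-tuples of vectors of V is less than 6·q^{j(j−1)/2}. -/

import Mathlib

open scoped BigOperators

section aux
variable {K : Type*} [Field K] {V : Type*} [AddCommGroup V] [Module K V]

/-- `Iso B W v w`: an isometry of `B` fixing `W` pointwise maps the tuple `v` to `w`. -/
def SpIso (B : LinearMap.BilinForm K V) (W : Submodule K V) {ι : Type*} (v w : ι → V) : Prop :=
  ∃ g : V ≃ₗ[K] V, (∀ x y : V, B (g x) (g y) = B x y) ∧ (∀ x ∈ W, g x = x) ∧ ∀ t, g (v t) = w t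

lemma sp_skew (B : LinearMap.BilinForm K V) (halt : ∀ v : V, B v v = 0) (x y : V) :
    B x y = - B y x := by
  have h := halt (x + y)
  simp only [map_add, LinearMap.add_apply, halt] at h
  linear_combination h

lemma sp_transv (B : LinearMap.BilinForm K V) (halt : ∀ v : V, B v v = 0)
    (W : Submodule K V) (v v' : V) (h : ∀ x ∈ W, B v x = B v' x) (hv : B v v' ≠ 0) :
    ∃ g : V ≃ₗ[K] V, (∀ x y : V, B (g x) (g y) = B x y) ∧ (∀ x ∈ W, g x = x) ∧ g v = v' := by
  have hf : ((B v v')⁻¹ • B (v - v')) (v' - v) = 0 := by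
    have : v' - v = -(v - v') := by abel
    rw [LinearMap.smul_apply, this, map_neg, halt]; simp
  have hw : ∀ x, B (v' - v) x = B v' x - B v x := fun x => by simp
  have hw2 : ∀ x, B (v - v') x = B v x - B v' x := fun x => by simp
  have hw' : ∀ x, B x (v' - v) = B v x - B v' x := fun x => by
    rw [sp_skew B halt, hw]; ring
  refine ⟨LinearEquiv.transvection hf, ?_, ?_, ?_⟩
  · intro x y
    simp only [LinearEquiv.transvection.apply, map_add, LinearMap.add_apply, map_smul,
      LinearMap.smul_apply, smul_eq_mul, hw, hw', hw2, halt]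
    have := sp_skew B halt v v'
    rw [this]
    ring
  · intro x hx
    rw [LinearEquiv.transvection.apply, LinearMap.smul_apply, hw2, h x hx]
    simp
  · have : B v' v = - B v v' := sp_skew B halt _ _
    simp only [LinearEquiv.transvection.apply, LinearMap.smul_apply, hw2, halt, this, smul_eq_mul]
    rw [zero_sub, neg_neg, inv_mul_cancel₀ hv]
    simp

lemma sp_sep [FiniteDimensional K V] (B : LinearMap.BilinForm K V) (halt : ∀ v : V, B v v = 0)
    (hnd : B.Nondegenerate) (W : Submodule K V) (v : V) (hv : v ∉ W) :
    ∃ y, (∀ x ∈ W, B y x = 0) ∧ B v y ≠ 0 := by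
  obtain ⟨f, hf, hW⟩ := Submodule.exists_le_ker_of_notMem hv
  refine ⟨(B.toDual hnd).symm f, fun x hx => ?_, ?_⟩
  · rw [LinearMap.BilinForm.apply_toDual_symm_apply]; exact hW hx
  · rw [sp_skew B halt, LinearMap.BilinForm.apply_toDual_symm_apply]
    simpa using hf

lemma sp_witt [FiniteDimensional K V] (B : LinearMap.BilinForm K V) (halt : ∀ v : V, B v v = 0)
    (hnd : B.Nondegenerate) (W : Submodule K V) (v v' : V) (hv : v ∉ W) (hv' : v' ∉ W)
    (h : ∀ x ∈ W, B v x = B v' x) :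
    ∃ g : V ≃ₗ[K] V, (∀ x y : V, B (g x) (g y) = B x y) ∧ (∀ x ∈ W, g x = x) ∧ g v = v' := by
  by_cases h0 : B v v' = 0
  swap
  · exact sp_transv B halt W v v' h h0
  have : ∃ y, (∀ x ∈ W, B y x = 0) ∧ B v y ≠ 0 ∧ B v' y ≠ 0 := by
    obtain ⟨a, ha, hva⟩ := sp_sep B halt hnd W v hv
    obtain ⟨b, hb, hvb⟩ := sp_sep B halt hnd W v' hv'
    by_cases h1 : B v' a = 0
    · by_cases h2 : B v b = 0
      · refine ⟨a + b, fun x hx => by simp [ha x hx, hb x hx], ?_, ?_⟩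
        · simpa [h2] using hva
        · simpa [h1] using hvb
      · exact ⟨b, hb, h2, hvb⟩
    · exact ⟨a, ha, hva, h1⟩
  obtain ⟨y, hy, h1, h2⟩ := this
  obtain ⟨g1, a1, b1, c1⟩ := sp_transv B halt W v (v + y) (fun x hx => by simp [hy x hx])
    (by simpa [halt] using h1)
  obtain ⟨g2, a2, b2, c2⟩ := sp_transv B halt W (v + y) v'
    (fun x hx => by simp [hy x hx, h x hx])
    (by
      rw [map_add, LinearMap.add_apply, h0, zero_add, sp_skew B halt]
      simpa using h2)
  refine ⟨g1.trans g2, fun x y => ?_, fun x hx => ?_, ?_⟩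
  · simp [a1, a2]
  · simp [b1 x hx, b2 x hx]
  · simp only [LinearEquiv.trans_apply, c1, c2]

lemma sp_reps [Fintype K] [FiniteDimensional K V] (B : LinearMap.BilinForm K V)
    (halt : ∀ v : V, B v v = 0) (hnd : B.Nondegenerate) (j : ℕ) :
    ∀ (r : ℕ) (W : Submodule K V), Module.finrank K W = r →
    ∃ S : Finset (Fin j → V),
      S.card ≤ Fintype.card K ^ (j * r) * ∏ i ∈ Finset.range j, (1 + Fintype.card K ^ i) ∧
      ∀ v, ∃ s ∈ S, SpIso B W v s := by
  classical
  have : Finite V := Module.finite_of_finite K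
  have : Fintype V := Fintype.ofFinite V
  induction j with
  | zero =>
    intro r W _
    refine ⟨{fun t => t.elim0}, by simp, fun v => ⟨_, Finset.mem_singleton_self _,
      LinearEquiv.refl K V, by simp, by simp, fun t => t.elim0⟩⟩
  | succ j ih =>
    intro r W hr
    set q := Fintype.card K with hq
    obtain ⟨S, hS, hS'⟩ := ih r W hr
    have key : ∀ c : Module.Dual K W, ∃ F : Finset (Fin (j+1) → V),
        F.card ≤ q ^ (j * (r + 1)) * ∏ i ∈ Finset.range j, (1 + q ^ i) ∧
        ∀ v ∉ W, (∀ x : W, B v x = c x) → ∀ u : Fin j → V,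
          ∃ s ∈ F, SpIso B W (Fin.cons v u : Fin (j+1) → V) s := by
      intro c
      by_cases hc : ∃ v0, v0 ∉ W ∧ ∀ x : W, B v0 x = c x
      · obtain ⟨v0, hv0, hc0⟩ := hc
        obtain ⟨S1, hS1, hS1'⟩ := ih (r+1) (W ⊔ Submodule.span K {v0})
          (by rw [Submodule.finrank_sup_span_singleton hv0, hr])
        refine ⟨S1.image (fun s => (Fin.cons v0 s : Fin (j+1) → V)),
          Finset.card_image_le.trans hS1, ?_⟩
        intro v hv hvc u
        obtain ⟨g1, a1, b1, c1⟩ := sp_witt B halt hnd W v v0 hv hv0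
          (fun x hx => (hvc ⟨x, hx⟩).trans (hc0 ⟨x, hx⟩).symm)
        obtain ⟨s, hs, g2, a2, b2, c2⟩ := hS1' (fun t => g1 (u t))
        refine ⟨_, Finset.mem_image_of_mem _ hs, g1.trans g2, fun x y => ?_, fun x hx => ?_, ?_⟩
        · simp [a1, a2]
        · simp [b1 x hx, b2 x (Submodule.mem_sup_left hx)]
        · intro t
          refine Fin.cases ?_ (fun t => ?_) t
          · simp only [LinearEquiv.trans_apply, Fin.cons_zero, c1]
            exact b2 _ (Submodule.mem_sup_right (Submodule.mem_span_singleton_self _))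
          · simpa using c2 t
      · exact ⟨∅, by simp, fun v hv hvc => (hc ⟨v, hv, hvc⟩).elim⟩
    choose F hF hF' using key
    have : Finite (Module.Dual K W) := Module.finite_of_finite K
    have : Fintype (Module.Dual K W) := Fintype.ofFinite _
    have cW : Fintype.card W = q ^ r := by rw [Module.card_eq_pow_finrank (K := K), hr]
    have cD : Fintype.card (Module.Dual K W) = q ^ r := by
      rw [Module.card_eq_pow_finrank (K := K), Subspace.dual_finrank_eq, hr]
    refine ⟨Finset.image₂ (fun (w : W) s => (Fin.cons (w : V) s : Fin (j+1) → V)) Finset.univ S ∪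
      Finset.univ.biUnion F, ?_, ?_⟩
    · refine (Finset.card_union_le _ _).trans ?_
      have h1 := (Finset.card_image₂_le
        (fun (w : W) s => (Fin.cons (w : V) s : Fin (j+1) → V)) Finset.univ S)
      have h2 := Finset.card_biUnion_le_card_mul Finset.univ F _ (fun c _ => hF c)
      rw [Finset.card_univ, cW] at h1
      rw [Finset.card_univ, cD] at h2
      refine (add_le_add (h1.trans (Nat.mul_le_mul_left _ hS)) h2).trans (le_of_eq ?_)
      rw [Finset.prod_range_succ]
      ring
    · intro v
      by_cases hv : v 0 ∈ W
      · obtain ⟨s, hs, g, a, b, c⟩ := hS' (Fin.tail v)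
        refine ⟨_, Finset.mem_union_left _ (Finset.mem_image₂_of_mem
          (Finset.mem_univ (⟨v 0, hv⟩ : W)) hs), g, a, b, ?_⟩
        intro t
        refine Fin.cases ?_ (fun t => ?_) t
        · simpa using b _ hv
        · exact c t
      · obtain ⟨s, hs, h⟩ := hF' ((B (v 0)).comp W.subtype) (v 0) hv (fun x => rfl) (Fin.tail v)
        rw [Fin.cons_self_tail] at h
        exact ⟨s, Finset.mem_union_right _ (Finset.mem_biUnion.2 ⟨_, Finset.mem_univ _, hs⟩), h⟩

lemma sp_bound (q : ℕ) (hq : 2 ≤ q) (j : ℕ) :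
    (∏ i ∈ Finset.range (j+2), (1 + q ^ i)) * q ^ (j+2) + 12 * q ^ ((j+2) * (j+2-1) / 2) ≤
      6 * q ^ ((j+2) * (j+2-1) / 2) * q ^ (j+2) := by
  induction j with
  | zero =>
    simp [Finset.prod_range_succ]
    obtain ⟨k, rfl⟩ := Nat.exists_eq_add_of_le hq
    ring_nf
    nlinarith [sq_nonneg k, Nat.zero_le (k^3)]
  | succ j ih =>
    rw [Finset.prod_range_succ, show j + 1 + 2 = (j + 2) + 1 by ring, Nat.triangle_succ,
      pow_add q _ (j+2), pow_succ q (j+2)]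
    set P := ∏ i ∈ Finset.range (j+2), (1 + q ^ i)
    set Q := q ^ ((j+2) * (j+2-1) / 2)
    set X := q ^ (j+2)
    have h1 := Nat.mul_le_mul_right ((1 + X) * q) ih
    have h2 : 12 * Q * X * 2 ≤ 12 * Q * X * q := Nat.mul_le_mul_left _ hq
    nlinarith [Nat.zero_le (Q * q), Nat.zero_le (Q*X*q)]

lemma sp_bound' (q : ℕ) (hq : 2 ≤ q) (j : ℕ) (hj : 1 ≤ j) :
    (∏ i ∈ Finset.range j, (1 + q ^ i)) < 6 * q ^ (j * (j-1) / 2) := by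
  obtain _ | _ | j := j
  · omega
  · simp
  · have h := sp_bound q hq j
    have hQ : 0 < q ^ ((j+2) * (j+2-1) / 2) := by positivity
    have h3 : (∏ i ∈ Finset.range (j+2), (1 + q ^ i)) * q ^ (j+2) <
        6 * q ^ ((j+2) * (j+2-1) / 2) * q ^ (j+2) := by omega
    exact lt_of_mul_lt_mul_right h3 (Nat.zero_le _)

end aux

/-- The number of orbits of the full symplectic group Sp(V), V = F_q^n with a
non-degenerate symplectic (alternating) form, on ordered j-tuples of vectors,
is less than 6·q^{j(j−1)/2}. -/
theorem stmt_8 (K : Type*) [Field K] [Fintype K]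
    (V : Type*) [AddCommGroup V] [Module K V] [FiniteDimensional K V]
    (n : ℕ) (hdim : Module.finrank K V = n)
    (B : LinearMap.BilinForm K V) (halt : ∀ v : V, B v v = 0)
    (hnd : B.Nondegenerate)
    (j : ℕ) (hj1 : 1 ≤ j) (hjn : j ≤ n) :
    Nat.card (Quot (fun v w : Fin j → V =>
      ∃ g : V ≃ₗ[K] V, (∀ x y : V, B (g x) (g y) = B x y) ∧ ∀ t, g (v t) = w t)) <
      6 * Fintype.card K ^ (j * (j - 1) / 2) := by
  classical
  obtain ⟨S, hS, hS'⟩ := sp_reps B halt hnd j 0 ⊥ (by simp)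
  refine lt_of_le_of_lt ?_ (sp_bound' (Fintype.card K) Fintype.one_lt_card j hj1)
  have hS2 : S.card ≤ ∏ i ∈ Finset.range j, (1 + Fintype.card K ^ i) := by simpa using hS
  refine le_trans ?_ hS2
  have := Nat.card_le_card_of_surjective (α := S) (β := Quot (fun v w : Fin j → V =>
      ∃ g : V ≃ₗ[K] V, (∀ x y : V, B (g x) (g y) = B x y) ∧ ∀ t, g (v t) = w t))
      (fun s => Quot.mk _ s.1) (by
        intro x
        obtain ⟨v, rfl⟩ := Quot.exists_rep x
        obtain ⟨s, hs, g, a, _, c⟩ := hS' v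
        exact ⟨⟨s, hs⟩, (Quot.sound ⟨g, a, c⟩).symm⟩)
  simpa using this
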